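/- Let (m_k), (n_k) be sequences of positive integers. Then for every k ≥ 1, b_{k,2} ≤ (m_1+n_1+1)(m_2+n_2+1)···(m_k+n_k+1). -/

import Mathlib

open MeasureTheory Filter Set Matrix Topology

noncomputable section

/-- Keane's 4×4 matrix `A_{m,n}` with rows (0,0,1,1), (m−1,m,0,0), (n,n,n−1,n), (1,1,1,1). -/
def Amat (m n : ℕ) : Matrix (Fin 4) (Fin 4) ℝ :=
  !![0, 0, 1, 1;
     (m : ℝ) - 1, (m : ℝ), 0, 0;
     (n : ℝ), (n : ℝ), (n : ℝ) - 1, (n : ℝ);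
     1, 1, 1, 1]

/-- `B_k = A_{m_1,n_1} A_{m_2,n_2} ⋯ A_{m_k,n_k}` (sequences indexed from 1). -/
def Bmat (m n : ℕ → ℕ) (k : ℕ) : Matrix (Fin 4) (Fin 4) ℝ :=
  ((List.range k).map fun i => Amat (m (i + 1)) (n (i + 1))).prod

/-- `|v|₁`, the sum of the absolute values of the entries of `v`. -/
def l1norm (v : Fin 4 → ℝ) : ℝ := ∑ i, |v i|

/-- `b_{k,i} = |B_k e_i|₁`; here columns are indexed from 0, so `e_i` is the
basis vector with a 1 in position `i` where `i : Fin 4` (e.g. the paper's `e_2` is `i = 1`). -/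
def bnum (m n : ℕ → ℕ) (k : ℕ) (i : Fin 4) : ℝ := l1norm fun j => Bmat m n k j i

/-- `Ā_{m,n}(v) = A_{m,n} v / |A_{m,n} v|₁`. -/
def Abar (m n : ℕ) (v : Fin 4 → ℝ) : Fin 4 → ℝ :=
  (l1norm (Amat m n *ᵥ v))⁻¹ • (Amat m n *ᵥ v)

/-- `barSeq m n k v = Ā_{m_1,n_1} Ā_{m_2,n_2} ⋯ Ā_{m_k,n_k} (v)`. -/
def barSeq (m n : ℕ → ℕ) : ℕ → (Fin 4 → ℝ) → Fin 4 → ℝ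
  | 0, v => v
  | k + 1, v => barSeq m n k (Abar (m (k + 1)) (n (k + 1)) v)

/-- The paper's `e₂ = (0,1,0,0)ᵀ`. -/
def e2 : Fin 4 → ℝ := ![0, 1, 0, 0]

/-- The paper's `e₃ = (0,0,1,0)ᵀ`. -/
def e3 : Fin 4 → ℝ := ![0, 0, 1, 0]

/-- Keane's conditions: the sequences are positive integers, `3(n_k+1) ≤ m_k ≤ (n_{k+1}+1)/2`
for all `k ≥ 1`, and `n_1 ≥ 10`. -/
def KeaneCond (m n : ℕ → ℕ) : Prop :=
  (∀ k, 1 ≤ k → 1 ≤ m k ∧ 1 ≤ n k) ∧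
  (∀ k, 1 ≤ k → 3 * (n k + 1) ≤ m k ∧ 2 * m k ≤ n (k + 1) + 1) ∧
  10 ≤ n 1

/-- The permutation (4213) (one-indexed: π(1)=4, π(2)=2, π(3)=1, π(4)=3), written zero-indexed. -/
def kperm : Fin 4 → Fin 4 := ![3, 1, 0, 2]

/-- The 4-interval exchange transformation with length vector `l` and permutation (4213):
on `I_j = [l_1+⋯+l_{j−1}, l_1+⋯+l_j)` it is `x ↦ x − ∑_{k<j} l_k + ∑_{π(k')<π(j)} l_{k'}`. -/
def iet (l : Fin 4 → ℝ) (x : ℝ) : ℝ :=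
  if x < l 0 then
    x + ∑ k ∈ Finset.univ.filter (fun k => kperm k < kperm 0), l k
  else if x < l 0 + l 1 then
    x - l 0 + ∑ k ∈ Finset.univ.filter (fun k => kperm k < kperm 1), l k
  else if x < l 0 + l 1 + l 2 then
    x - (l 0 + l 1) + ∑ k ∈ Finset.univ.filter (fun k => kperm k < kperm 2), l k
  else
    x - (l 0 + l 1 + l 2) + ∑ k ∈ Finset.univ.filter (fun k => kperm k < kperm 3), l k

/-- The IET regarded as a self-map of `ℝ`, extended by the identity off `[0,1)`
(a measure `μ` with `μ [0,1) = 1` then plays the role of a Borel measure on `[0,1)`). -/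
def ietFull (l : Fin 4 → ℝ) (x : ℝ) : ℝ :=
  if x ∈ Set.Ico (0 : ℝ) 1 then iet l x else x

theorem Bmat_succ (m n : ℕ → ℕ) (k : ℕ) :
    Bmat m n (k + 1) = Bmat m n k * Amat (m (k + 1)) (n (k + 1)) := by
  simp [Bmat, List.range_succ]

theorem Amat_nonneg {m n : ℕ} (hm : 1 ≤ m) (hn : 1 ≤ n) (i j : Fin 4) : 0 ≤ Amat m n i j := by
  have hm' : (1 : ℝ) ≤ m := by exact_mod_cast hm
  have hn' : (1 : ℝ) ≤ n := by exact_mod_cast hn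
  fin_cases i <;> fin_cases j <;> simp [Amat] <;> assumption

theorem Bmat_nonneg {m n : ℕ → ℕ} (hpos : ∀ k, 1 ≤ m k ∧ 1 ≤ n k) (k : ℕ) (i j : Fin 4) :
    0 ≤ Bmat m n k i j := by
  induction k generalizing j with
  | zero =>
    simp only [Bmat, List.range_zero, List.map_nil, List.prod_nil, Matrix.one_apply]
    split_ifs <;> norm_num
  | succ k ih =>
    rw [Bmat_succ, Matrix.mul_apply]
    exact Finset.sum_nonneg fun l _ => mul_nonneg (ih l) (Amat_nonneg (hpos _).1 (hpos _).2 l j)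

theorem bnum_eq_sum {m n : ℕ → ℕ} (hpos : ∀ k, 1 ≤ m k ∧ 1 ≤ n k) (k : ℕ) (j : Fin 4) :
    bnum m n k j = ∑ i, Bmat m n k i j :=
  show ∑ i, |Bmat m n k i j| = _ from Finset.sum_congr rfl fun i _ => abs_of_nonneg (Bmat_nonneg hpos k i j)

theorem bnum_nonneg (m n : ℕ → ℕ) (k : ℕ) (j : Fin 4) : 0 ≤ bnum m n k j :=
  show 0 ≤ ∑ i, |Bmat m n k i j| from Finset.sum_nonneg fun _ _ => abs_nonneg _

theorem bnum_zero (m n : ℕ → ℕ) (j : Fin 4) : bnum m n 0 j = 1 := by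
  fin_cases j <;> simp [bnum, l1norm, Bmat, Fin.sum_univ_four, Matrix.one_apply]

/-- The column sums of `B_{k+1}` are obtained from those of `B_k` by multiplying by `A` on the
right. -/
theorem bnum_succ {m n : ℕ → ℕ} (hpos : ∀ k, 1 ≤ m k ∧ 1 ≤ n k) (k : ℕ) (j : Fin 4) :
    bnum m n (k + 1) j = ∑ l, bnum m n k l * Amat (m (k + 1)) (n (k + 1)) l j := by
  simp only [bnum_eq_sum hpos, Bmat_succ, Matrix.mul_apply, Finset.sum_mul]
  exact Finset.sum_comm

/-- The second column of `B_k` has the largest sum. -/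
theorem bnum_le_bnum_one {m n : ℕ → ℕ} (hpos : ∀ k, 1 ≤ m k ∧ 1 ≤ n k) (k : ℕ) (j : Fin 4) :
    bnum m n k j ≤ bnum m n k 1 := by
  induction k generalizing j with
  | zero => simp [bnum_zero]
  | succ k ih =>
    have hm : (1 : ℝ) ≤ m (k + 1) := by exact_mod_cast (hpos (k + 1)).1
    have h0 := ih 0
    have h1 := le_mul_of_one_le_right (bnum_nonneg m n k 1) hm
    have h2 := bnum_nonneg m n k 2
    have h3 := bnum_nonneg m n k 1
    fin_cases j <;> simp [bnum_succ hpos, Fin.sum_univ_four, Amat] <;> linarith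

/-- Lemma 10: `b_{k,2} ≤ (m_1+n_1+1)(m_2+n_2+1)⋯(m_k+n_k+1)`. -/
theorem lemma_ten (m n : ℕ → ℕ)
    (hpos : ∀ k, 1 ≤ m k ∧ 1 ≤ n k) :
    ∀ k, 1 ≤ k →
      bnum m n k 1 ≤ ∏ i ∈ Finset.Icc 1 k, ((m i : ℝ) + (n i : ℝ) + 1) := by
  intro k _
  induction k with
  | zero => simp [bnum_zero]
  | succ k ih =>
    rw [Finset.prod_Icc_succ_top (by omega)]
    have h2 := mul_le_mul_of_nonneg_right (bnum_le_bnum_one hpos k 2)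
      (Nat.cast_nonneg (α := ℝ) (n (k + 1)))
    have h3 := bnum_le_bnum_one hpos k 3
    calc bnum m n (k + 1) 1
        ≤ bnum m n k 1 * ((m (k + 1) : ℝ) + (n (k + 1) : ℝ) + 1) := by
          simp [bnum_succ hpos k, Fin.sum_univ_four, Amat]
          linarith
      _ ≤ _ := by
          refine mul_le_mul_of_nonneg_right ?_ (by positivity)
          rcases Nat.eq_zero_or_pos k with rfl | hk
          · simp [bnum_zero]
          · exact ih hk
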